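/- (Fuzzy stability of the additive Cauchy equation, Theorem 3.1 of Mirmostafaee–Moslehian, as used in the paper) Let A be a ring, (B, N) a fuzzy Banach algebra, and (C, N') a fuzzy normed linear space. Let φ : A × A → C be a function such that for some 0 < α < 2, N'(φ(2a, 2b), t) ≥ N'(α φ(a,b), t) for all a, b ∈ A and all t > 0. Suppose f : A → B satisfies N(f(a+b) − f(a) − f(b), t) ≥ N'(φ(a,b), t) for all a, b ∈ A and all t > 0. Then there exists an additive function h : A → B such that N(f(a) − h(a), t) ≥ N'((2/(2−α)) φ(a,a), t) for all a ∈ A and all t > 0. -/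

import Mathlib

open Filter Topology

/-- A fuzzy norm on a real linear space `X` (conditions (N1)–(N6), with values in `[0,1]`). -/
structure IsFuzzyNorm {X : Type*} [AddCommGroup X] [Module ℝ X] (N : X → ℝ → ℝ) : Prop where
  nonneg : ∀ (x : X) (a : ℝ), 0 ≤ N x a
  le_one : ∀ (x : X) (a : ℝ), N x a ≤ 1
  N1 : ∀ (x : X) (a : ℝ), a ≤ 0 → N x a = 0
  N2 : ∀ x : X, x = 0 ↔ ∀ a : ℝ, 0 < a → N x a = 1
  N3 : ∀ (x : X) (a b : ℝ), a ≠ 0 → N (a • x) b = N x (b / |a|)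
  N4 : ∀ (x y : X) (a b : ℝ), min (N x a) (N y b) ≤ N (x + y) (a + b)
  N5_mono : ∀ x : X, Monotone (N x)
  N5_lim : ∀ x : X, Tendsto (N x) atTop (𝓝 1)
  N6 : ∀ x : X, x ≠ 0 → Continuous (N x)

/-- Convergence of a sequence to `x` in a fuzzy normed linear space:
`lim_{n→∞} N (s n - x) a = 1` for all `a > 0`. -/
def FuzzyTendsto {X : Type*} [AddCommGroup X] [Module ℝ X] (N : X → ℝ → ℝ)
    (s : ℕ → X) (x : X) : Prop :=
  ∀ a : ℝ, 0 < a → Tendsto (fun n => N (s n - x) a) atTop (𝓝 1)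

/-- A sequence is Cauchy in a fuzzy normed linear space. -/
def FuzzyCauchy {X : Type*} [AddCommGroup X] [Module ℝ X] (N : X → ℝ → ℝ)
    (s : ℕ → X) : Prop :=
  ∀ ε : ℝ, 0 < ε → ∀ a : ℝ, 0 < a → ∃ n₀ : ℕ, ∀ n ≥ n₀, ∀ p : ℕ, 0 < p →
    1 - ε < N (s (n + p) - s n) a

/-- A fuzzy norm is complete if every Cauchy sequence converges. -/
def FuzzyComplete {X : Type*} [AddCommGroup X] [Module ℝ X] (N : X → ℝ → ℝ) : Prop :=
  ∀ s : ℕ → X, FuzzyCauchy N s → ∃ x : X, FuzzyTendsto N s x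

/-- A fuzzy Banach algebra: a real algebra with a complete fuzzy norm satisfying
`N (x*y) (a*b) ≥ min (N x a) (N y b)`. -/
structure IsFuzzyBanachAlgebra {X : Type*} [Ring X] [Algebra ℝ X] (N : X → ℝ → ℝ) : Prop where
  toIsFuzzyNorm : IsFuzzyNorm N
  complete : FuzzyComplete N
  mul : ∀ (x y : X) (a b : ℝ), min (N x a) (N y b) ≤ N (x * y) (a * b)

namespace IsFuzzyNorm

variable {X : Type*} [AddCommGroup X] [Module ℝ X] {N : X → ℝ → ℝ}

theorem apply_neg (hN : IsFuzzyNorm N) (x : X) (t : ℝ) : N (-x) t = N x t := by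
  have h := hN.N3 x (-1) t (by norm_num)
  simpa using h

theorem apply_sub_comm (hN : IsFuzzyNorm N) (x y : X) (t : ℝ) : N (x - y) t = N (y - x) t := by
  rw [← hN.apply_neg, neg_sub]

theorem apply_smul_mul (hN : IsFuzzyNorm N) (x : X) {c : ℝ} (hc : 0 < c) (t : ℝ) :
    N (c • x) (c * t) = N x t := by
  rw [hN.N3 x c _ hc.ne', abs_of_pos hc, mul_div_cancel_left₀ _ hc.ne']

theorem fuzzyTendsto_sub (hN : IsFuzzyNorm N) {u v : ℕ → X} {x y : X}
    (hu : FuzzyTendsto N u x) (hv : FuzzyTendsto N v y) :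
    FuzzyTendsto N (fun n => u n - v n) (x - y) := by
  intro t ht
  have h := (hu (t / 2) (by positivity)).min (hv (t / 2) (by positivity))
  rw [min_self] at h
  refine tendsto_of_tendsto_of_tendsto_of_le_of_le h tendsto_const_nhds (fun n => ?_)
    fun n => hN.le_one _ _
  have h4 := hN.N4 (u n - x) (-(v n - y)) (t / 2) (t / 2)
  rw [hN.apply_neg, add_halves] at h4
  refine h4.trans_eq (congrArg (N · t) ?_)
  simp only
  abel

theorem fuzzyTendsto_unique (hN : IsFuzzyNorm N) {u : ℕ → X} {x y : X}
    (hx : FuzzyTendsto N u x) (hy : FuzzyTendsto N u y) : x = y := by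
  rw [← sub_eq_zero, hN.N2]
  intro t ht
  have h := hN.fuzzyTendsto_sub hx hy t ht
  simp only [sub_self, zero_sub, hN.apply_neg] at h
  exact tendsto_nhds_unique tendsto_const_nhds h

/-- A sequence whose consecutive differences are dominated by a geometric progression. -/
theorem apply_sub_of_geometric (hN : IsFuzzyNorm N) {u : ℕ → X} {r t m : ℝ} (hr0 : 0 < r)
    (ht : 0 < t) (hm : m ≤ 1)
    (hu : ∀ n, m ≤ N (u (n + 1) - u n) (r ^ n * ((1 - r) * t))) (n p : ℕ) :
    m ≤ N (u (n + p) - u n) (r ^ n * t * (3 / 2 - r ^ p)) := by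
  induction p with
  | zero =>
    have h0 : N (0 : X) (r ^ n * t * (3 / 2 - r ^ 0)) = 1 :=
      (hN.N2 0).1 rfl _ (mul_pos (by positivity) (by norm_num))
    simpa using hm.trans_eq h0.symm
  | succ p ih =>
    have h := (le_min (hu (n + p)) ih).trans (hN.N4 _ _ _ _)
    refine h.trans_eq ?_
    rw [sub_add_sub_cancel, add_assoc]
    ring_nf

theorem apply_sub_le_of_geometric (hN : IsFuzzyNorm N) {u : ℕ → X} {r t m : ℝ} (hr0 : 0 < r)
    (ht : 0 < t) (hm : m ≤ 1)
    (hu : ∀ n, m ≤ N (u (n + 1) - u n) (r ^ n * ((1 - r) * t))) (n p : ℕ) :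
    m ≤ N (u (n + p) - u n) (r ^ n * (3 / 2 * t)) := by
  refine (hN.apply_sub_of_geometric hr0 ht hm hu n p).trans (hN.N5_mono _ ?_)
  have : 0 < r ^ n * t * r ^ p := by positivity
  linarith

/-- A sequence whose consecutive differences are geometrically dominated, with the bound `g t`
tending to `1`, is Cauchy. -/
theorem fuzzyCauchy_of_geometric (hN : IsFuzzyNorm N) {u : ℕ → X} {r : ℝ} {g : ℝ → ℝ}
    (hr0 : 0 < r) (hr1 : r < 1) (hg1 : ∀ t, g t ≤ 1) (hg : Tendsto g atTop (𝓝 1))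
    (hu : ∀ n t, 0 < t → g t ≤ N (u (n + 1) - u n) (r ^ n * ((1 - r) * t))) :
    FuzzyCauchy N u := by
  intro ε hε a ha
  obtain ⟨t, hgt, ht⟩ :=
    ((hg.eventually_const_lt (show 1 - ε < 1 by linarith)).and (eventually_gt_atTop 0)).exists
  have hlim : Tendsto (fun n => r ^ n * (3 / 2 * t)) atTop (𝓝 0) := by
    simpa using (tendsto_pow_atTop_nhds_zero_of_lt_one hr0.le hr1).mul_const (3 / 2 * t)
  obtain ⟨n₀, hn₀⟩ := eventually_atTop.1 (hlim.eventually_lt_const ha)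
  refine ⟨n₀, fun n hn p _ => hgt.trans_le ?_⟩
  exact (hN.apply_sub_le_of_geometric hr0 ht (hg1 t) (fun n => hu n t ht) n p).trans
    (hN.N5_mono _ (hn₀ n hn).le)

/-- The distance from the initial term to the limit of a geometrically dominated sequence. -/
theorem apply_sub_limit_of_geometric (hN : IsFuzzyNorm N) {u : ℕ → X} {x : X} {r t m : ℝ}
    (hr0 : 0 < r) (ht : 0 < t) (hm : m ≤ 1)
    (hu : ∀ n, m ≤ N (u (n + 1) - u n) (r ^ n * ((1 - r) * t))) (hx : FuzzyTendsto N u x) :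
    m ≤ N (u 0 - x) (2 * t) := by
  have h := (tendsto_const_nhds (x := m)).min (hx (t / 2) (by positivity))
  rw [min_eq_left hm] at h
  refine le_of_tendsto' h fun p => ?_
  have h0 := hN.apply_sub_le_of_geometric hr0 ht hm hu 0 p
  rw [zero_add, pow_zero, one_mul, hN.apply_sub_comm] at h0
  refine (min_le_min_right _ h0).trans ((hN.N4 _ _ _ _).trans_eq ?_)
  rw [sub_add_sub_cancel]
  ring_nf

end IsFuzzyNorm

/-- The control inequality for doubling, iterated `n` times. -/
theorem IsFuzzyNorm.apply_le_apply_pow_two_mul {A C : Type*} [Ring A] [AddCommGroup C]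
    [Module ℝ C] {N' : C → ℝ → ℝ} (hN' : IsFuzzyNorm N') {φ : A → A → C} {α : ℝ} (hα0 : 0 < α)
    (hφ : ∀ (a b : A) (t : ℝ), 0 < t → N' (α • φ a b) t ≤ N' (φ (2 * a) (2 * b)) t)
    (n : ℕ) (a b : A) {t : ℝ} (ht : 0 < t) :
    N' (φ a b) t ≤ N' (φ (2 ^ n * a) (2 ^ n * b)) (α ^ n * t) := by
  induction n with
  | zero => simp
  | succ n ih =>
    have h := hφ (2 ^ n * a) (2 ^ n * b) (α * (α ^ n * t)) (by positivity)
    rw [hN'.apply_smul_mul _ hα0] at h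
    simpa only [pow_succ', mul_assoc] using ih.trans h

/-- Fuzzy stability of the additive Cauchy equation (Theorem 3.1 of
Mirmostafaee–Moslehian, as used in the paper). -/
theorem stmt_13 {A : Type*} [Ring A] {B : Type*} [Ring B] [Algebra ℝ B]
    {C : Type*} [AddCommGroup C] [Module ℝ C]
    (N : B → ℝ → ℝ) (N' : C → ℝ → ℝ)
    (hN : IsFuzzyBanachAlgebra N) (hN' : IsFuzzyNorm N')
    (φ : A → A → C) (α : ℝ) (hα0 : 0 < α) (hα2 : α < 2)
    (hφ : ∀ (a b : A) (t : ℝ), 0 < t → N' (α • φ a b) t ≤ N' (φ (2 * a) (2 * b)) t)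
    (f : A → B)
    (hadd : ∀ (a b : A) (t : ℝ), 0 < t → N' (φ a b) t ≤ N (f (a + b) - f a - f b) t) :
    ∃ h : A → B, (∀ a b : A, h (a + b) = h a + h b) ∧
      ∀ (a : A) (t : ℝ), 0 < t → N' ((2 / (2 - α)) • φ a a) t ≤ N (f a - h a) t := by
  have hB := hN.toIsFuzzyNorm
  have hr0 : 0 < α / 2 := by positivity
  have hr1 : α / 2 < 1 := by linarith
  set s : A → ℕ → B := fun a n => ((2 : ℝ) ^ n)⁻¹ • f (2 ^ n * a) with hs
  have hdef (a b : A) (n : ℕ) (t : ℝ) (ht : 0 < t) :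
      N' (φ a b) t ≤ N (s (a + b) n - s a n - s b n) ((α / 2) ^ n * t) := by
    refine (hN'.apply_le_apply_pow_two_mul hα0 hφ n a b ht).trans
      ((hadd _ _ _ (by positivity)).trans_eq ?_)
    rw [← hB.apply_smul_mul _ (c := ((2 : ℝ) ^ n)⁻¹) (by positivity), ← mul_add, smul_sub,
      smul_sub, div_pow]
    congr 1
    ring
  have hstep (a : A) (n : ℕ) (t : ℝ) (ht : 0 < t) : N' (φ a a) ((2 - α) * t) ≤
      N (s a (n + 1) - s a n) ((α / 2) ^ n * ((1 - α / 2) * t)) := by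
    refine (hdef a a n _ (mul_pos (by linarith) ht)).trans_eq ?_
    rw [← hB.apply_smul_mul _ (c := (2 : ℝ)⁻¹) (by positivity)]
    congr 1
    · have h2 : (2 : A) ^ (n + 1) * a = 2 ^ n * (a + a) := by
        rw [pow_succ, mul_assoc, two_mul]
      simp only [hs, h2, pow_succ (2 : ℝ)]
      module
    · ring
  have hcauchy (a : A) : FuzzyCauchy N (s a) :=
    hB.fuzzyCauchy_of_geometric hr0 hr1 (fun t => hN'.le_one _ _)
      ((hN'.N5_lim (φ a a)).comp (tendsto_id.const_mul_atTop (show 0 < 2 - α by linarith)))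
      (hstep a)
  choose h hh using fun a => hN.complete (s a) (hcauchy a)
  refine ⟨h, fun a b => ?_, fun a t ht => ?_⟩
  · have hzero : FuzzyTendsto N (fun n => s (a + b) n - s a n - s b n) 0 := by
      intro t ht
      have hlim : Tendsto (fun n => ((α / 2) ^ n)⁻¹ * t) atTop atTop := by
        simp only [← inv_pow]
        exact (tendsto_pow_atTop_atTop_of_one_lt ((one_lt_inv₀ hr0).2 hr1)).atTop_mul_const ht
      refine tendsto_of_tendsto_of_tendsto_of_le_of_le ((hN'.N5_lim (φ a b)).comp hlim)
        tendsto_const_nhds (fun n => ?_) fun n => hB.le_one _ _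
      have := hdef a b n (((α / 2) ^ n)⁻¹ * t) (by positivity)
      rwa [mul_inv_cancel_left₀ (by positivity), ← sub_zero (_ - s b n)] at this
    have := hB.fuzzyTendsto_unique
      (hB.fuzzyTendsto_sub (hB.fuzzyTendsto_sub (hh (a + b)) (hh a)) (hh b)) hzero
    rwa [sub_sub, sub_eq_zero] at this
  · have h2α : 0 < 2 - α := by linarith
    have := hB.apply_sub_limit_of_geometric hr0 (half_pos ht) (hN'.le_one _ _)
      (fun n => hstep a n (t / 2) (half_pos ht)) (hh a)
    rw [hN'.N3 _ _ _ (by positivity), abs_of_pos (by positivity)]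
    convert this using 2
    · field_simp
    · simp [hs]
    · ring
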